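/- Let T be a nonnegative random variable with E[T] = 1 and E[e^{sT}] < ∞ for s in a neighborhood of 0. For each θ ≤ 0 sufficiently small in absolute value, there exists a unique ζ(θ) with e^{θ}·E[e^{−ζ(θ)T}] = 1, and ζ(θ) = θ + (c²/2)θ² + o(θ²) as θ → 0, where c² = Var(T). -/

import Mathlib

open MeasureTheory ProbabilityTheory Filter Asymptotics

open Topology in
lemma cgf_taylor_two {Ω : Type*} [MeasurableSpace Ω] (μ : Measure Ω) [IsProbabilityMeasure μ]
    (T : Ω → ℝ) (hmean : ∫ ω, T ω ∂μ = 1)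
    (h0 : (0 : ℝ) ∈ interior (integrableExpSet T μ)) :
    (fun x : ℝ => cgf T μ x - (x + ProbabilityTheory.variance T μ / 2 * x ^ 2)) =o[𝓝 0]
      (fun x : ℝ => x ^ 2) := by
  have hopen : IsOpen (interior (integrableExpSet T μ)) := isOpen_interior
  have hcd : ContDiffOn ℝ (2 : ℕ) (cgf T μ) (interior (integrableExpSet T μ)) :=
    fun x hx => ((analyticAt_cgf hx).contDiffAt).contDiffWithinAt
  have h := taylor_isLittleO (convex_integrableExpSet.interior) h0 hcd
  rw [hopen.nhdsWithin_eq h0] at h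
  have hv : iteratedDeriv 2 (cgf T μ) 0 = ProbabilityTheory.variance T μ := by
    rw [← variance_tilted_mul h0]; simp
  have hd : deriv (cgf T μ) 0 = 1 := by rw [deriv_cgf_zero h0]; simp [hmean]
  refine (h.congr' ?_ ?_)
  · refine Eventually.of_forall fun x => ?_
    simp only [taylor_within_apply, Finset.sum_range_succ, Finset.sum_range_zero,
      iteratedDerivWithin_of_isOpen hopen h0, hv, iteratedDeriv_one, iteratedDeriv_zero, hd,
      cgf_zero, Nat.factorial]
    simp
    ring
  · simp

open Topology in
lemma inverse_expand (g : ℝ → ℝ) (V : ℝ) (hg0 : g 0 = 0) (hg : HasStrictDerivAt g 1 0)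
    (hgt : (fun x : ℝ => g x - x + V / 2 * x ^ 2) =o[𝓝 0] (fun x : ℝ => x ^ 2)) :
    ∃ h : ℝ → ℝ, Tendsto h (𝓝 0) (𝓝 0) ∧ (∀ᶠ x in 𝓝 0, h (g x) = x) ∧
      (∀ᶠ y in 𝓝 0, g (h y) = y) ∧
      (fun y : ℝ => h y - y - V / 2 * y ^ 2) =o[𝓝 0] (fun y : ℝ => y ^ 2) := by
  have hl := hg.eventually_left_inverse one_ne_zero
  have hr := hg.eventually_right_inverse one_ne_zero
  have hd := hg.to_localInverse one_ne_zero
  generalize hg.localInverse g 1 0 one_ne_zero = h at hl hr hd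
  rw [hg0] at hr hd
  have hh0 : h 0 = 0 := by simpa [hg0] using hl.self_of_nhds
  have ht : Tendsto h (𝓝 0) (𝓝 0) := by
    simpa [hh0] using hd.hasDerivAt.continuousAt.tendsto
  have h1 : (fun y => h y - y) =o[𝓝 0] (fun y : ℝ => y) := by
    simpa [hh0] using hd.hasDerivAt.isLittleO
  have h2 : h =O[𝓝 0] (fun y : ℝ => y) := by
    simpa using h1.isBigO.add (isBigO_refl (fun y : ℝ => y) (𝓝 0))
  refine ⟨h, ht, hl, hr, ?_⟩
  have h3 : (fun y => g (h y) - h y + V / 2 * (h y) ^ 2) =o[𝓝 0] (fun y : ℝ => y ^ 2) :=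
    (hgt.comp_tendsto ht).trans_isBigO (h2.pow 2)
  have h4 : (fun y => V / 2 * ((h y - y) * (h y + y))) =o[𝓝 0] (fun y : ℝ => y ^ 2) := by
    have := (h1.mul_isBigO (h2.add (isBigO_refl (fun y : ℝ => y) (𝓝 0)))).const_mul_left (V / 2)
    simpa [pow_two] using this
  refine (h4.sub h3).congr' ?_ (Eventually.of_forall fun _ => rfl)
  filter_upwards [hr] with y hy
  rw [hy]; ring



/-- For a nonnegative random variable `T` with mean 1 and finite exponential moments
near 0, for each small `θ ≤ 0` there is a unique `ζ(θ)` with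
`e^θ E[e^{−ζ(θ)T}] = 1`, and `ζ(θ) = θ + (c²/2)θ² + o(θ²)` as `θ → 0⁻`,
where `c² = Var(T)`. -/
theorem stmt15 {Ω : Type*} [MeasureSpace Ω] [IsProbabilityMeasure (ℙ : Measure Ω)]
    (T : Ω → ℝ) (hTm : Measurable T) (hT : ∀ᵐ ω ∂ℙ, 0 ≤ T ω)
    (hmean : ∫ ω, T ω ∂ℙ = 1)
    (s₀ : ℝ) (hs₀ : 0 < s₀)
    (hint : ∀ s : ℝ, |s| ≤ s₀ → Integrable (fun ω => Real.exp (s * T ω)) ℙ) :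
    ∃ δ : ℝ, 0 < δ ∧ ∃ ζ : ℝ → ℝ,
      (∀ θ : ℝ, θ ≤ 0 → |θ| ≤ δ →
        (Real.exp θ * ∫ ω, Real.exp (-(ζ θ) * T ω) ∂ℙ = 1 ∧
          ∀ ζ' : ℝ, |ζ'| ≤ δ →
            Real.exp θ * ∫ ω, Real.exp (-ζ' * T ω) ∂ℙ = 1 → ζ' = ζ θ)) ∧
      (fun θ : ℝ => ζ θ - θ - (ProbabilityTheory.variance T ℙ / 2) * θ ^ 2)
        =o[nhdsWithin 0 (Set.Iic 0)] (fun θ : ℝ => θ ^ 2) := by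

  have hmem : integrableExpSet T (ℙ : Measure Ω) ∈ nhds (0 : ℝ) := by
    filter_upwards [Metric.closedBall_mem_nhds (0 : ℝ) hs₀] with s hs
    exact hint s (by simpa using hs)
  have h0 : (0 : ℝ) ∈ interior (integrableExpSet T (ℙ : Measure Ω)) :=
    mem_interior_iff_mem_nhds.2 hmem
  have htay := cgf_taylor_two (ℙ : Measure Ω) T hmean h0
  have hd : deriv (cgf T (ℙ : Measure Ω)) 0 = 1 := by rw [deriv_cgf_zero h0]; simp [hmean]
  have hneg : Tendsto (fun x : ℝ => -x) (nhds 0) (nhds 0) := by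
    simpa using (continuous_neg (G := ℝ)).tendsto 0
  have hstrict : HasStrictDerivAt (fun x => -cgf T (ℙ : Measure Ω) (-x)) 1 0 := by
    have ha : HasStrictDerivAt (cgf T (ℙ : Measure Ω)) 1 (-(0 : ℝ)) := by
      have := (analyticAt_cgf h0).hasStrictDerivAt
      rw [hd] at this
      simpa using this
    have hb := (ha.comp (0 : ℝ) (hasStrictDerivAt_neg (0 : ℝ))).neg
    have e : -((1 : ℝ) * -1) = 1 := by norm_num
    rw [e] at hb
    exact hb
  obtain ⟨h, ht, hl, hr, ho⟩ := inverse_expand (fun x => -cgf T (ℙ : Measure Ω) (-x))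
    (ProbabilityTheory.variance T ℙ) (by simp) hstrict (by
      refine (htay.comp_tendsto hneg).neg_left.congr (fun x => ?_) (fun x => ?_)
      · simp only [Function.comp]; ring
      · simp)
  have hkey : ∀ z θ : ℝ, -z ∈ integrableExpSet T (ℙ : Measure Ω) →
      (Real.exp θ * ∫ ω, Real.exp (-z * T ω) ∂ℙ = 1 ↔ -cgf T (ℙ : Measure Ω) (-z) = θ) := by
    intro z θ hz
    have : ∫ ω, Real.exp (-z * T ω) ∂ℙ = Real.exp (cgf T (ℙ : Measure Ω) (-z)) := by
      rw [exp_cgf hz]; rfl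
    rw [this, ← Real.exp_add, Real.exp_eq_one_iff]
    constructor <;> intro h <;> linarith
  have hev : ∀ᶠ x in nhds (0 : ℝ), (h (-cgf T (ℙ : Measure Ω) (-x)) = x ∧
      -cgf T (ℙ : Measure Ω) (-(h x)) = x) ∧ -x ∈ integrableExpSet T (ℙ : Measure Ω) ∧
      -(h x) ∈ integrableExpSet T (ℙ : Measure Ω) :=
    (hl.and hr).and ((hneg.eventually hmem).and ((hneg.comp ht).eventually hmem))
  obtain ⟨δ, hδ, hball⟩ := Metric.nhds_basis_closedBall.eventually_iff.1 hev
  refine ⟨δ, hδ, h, fun θ _ hθ => ⟨?_, fun ζ' hζ' he => ?_⟩, ho.mono nhdsWithin_le_nhds⟩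
  · have hb := hball (x := θ) (by simpa using hθ)
    exact (hkey _ _ hb.2.2).2 hb.1.2
  · have hb := hball (x := ζ') (by simpa using hζ')
    have := (hkey _ _ hb.2.1).1 he
    rw [← this]
    exact hb.1.1.symm
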